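/- Every multi-player perfect-information game with probabilistic transitions, with countable state space, nonempty finite action sets, and payoff functions u_i : P → ℝ that are bounded and continuous, admits a secure equilibrium. -/

import Mathlib

open MeasureTheory

/-- A multi-player perfect-information game with probabilistic transitions:
a set of players `N`, a state space `S` with initial state `init`, a controlling
player `ctrl s` and a nonempty finite action set `act s` for every state `s`, and
a transition probability measure `q s a` for every state `s` and action `a`.
The supports of the transition measures are mutually disjoint and every state is
reachable from the initial state, so every state is reached from `init` via
exactly one finite history (states correspond bijectively to histories). -/
structure PGame (N S A : Type*) where
  init : S
  ctrl : S → N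
  act : S → Finset A
  act_nonempty : ∀ s, (act s).Nonempty
  q : S → A → PMF S
  unique_pred : ∀ z s a s' a', a ∈ act s → a' ∈ act s' →
    z ∈ (q s a).support → z ∈ (q s' a').support → s = s' ∧ a = a'
  init_not_succ : ∀ s a, a ∈ act s → init ∉ (q s a).support
  reach : ∀ z, Relation.ReflTransGen (fun s t => ∃ a ∈ act s, t ∈ (q s a).support) init z

namespace PGame

variable {N S A : Type*} (G : PGame N S A)

/-- A play: an infinite alternating sequence of states and actions, starting at the
initial state, choosing legal actions and moving to successor states. -/
def IsPlay (p : ℕ → S × A) : Prop :=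
  (p 0).1 = G.init ∧
    ∀ m, (p m).2 ∈ G.act (p m).1 ∧ (p (m + 1)).1 ∈ (G.q (p m).1 (p m).2).support

/-- The set of plays of the game. -/
def Play : Type _ := { p : ℕ → S × A // G.IsPlay p }

/-- The set of plays carries the topology generated by the cylinder sets, i.e. the
topology induced by the product of the discrete topologies. -/
instance : TopologicalSpace G.Play :=
  letI : TopologicalSpace S := ⊥
  letI : TopologicalSpace A := ⊥
  inferInstanceAs (TopologicalSpace { p : ℕ → S × A // G.IsPlay p })

/-- The Borel σ-algebra on plays. -/
instance : MeasurableSpace G.Play := borel G.Play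

/-- A strategy of player `i`: a choice of a legal action in every state controlled
by `i`. -/
def Strat (i : N) : Type _ := { f : S → A // ∀ s, G.ctrl s = i → f s ∈ G.act s }

/-- A strategy profile. -/
def Profile : Type _ := ∀ i : N, G.Strat i

/-- The profile `σ` with player `i`'s strategy replaced by `τi`. -/
noncomputable def comb (i : N) (τi : G.Strat i) (σ : G.Profile) : G.Profile :=
  haveI := Classical.decEq N
  Function.update σ i τi

/-- The action that profile `σ` plays in state `s`. -/
def playFun (σ : G.Profile) (s : S) : A := (σ (G.ctrl s)).1 s

/-- The cylinder set of plays agreeing with the play `p0` on the first `n`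
coordinates. -/
def cylSet (p0 : G.Play) (n : ℕ) : Set G.Play := { p : G.Play | ∀ m < n, p.1 m = p0.1 m }

open Classical in
/-- `μ` is the family of Borel probability measures on plays induced by the strategy
profiles via the Ionescu–Tulcea construction applied to `q`; it is uniquely
characterized by the probabilities it assigns to the cylinder sets: actions are
chosen deterministically according to the profile and states are drawn from the
transition probabilities. -/
def IsInducedMeasure (μ : G.Profile → Measure G.Play) : Prop :=
  (∀ σ, IsProbabilityMeasure (μ σ)) ∧
    ∀ (σ : G.Profile) (p0 : G.Play) (n : ℕ),
      μ σ (G.cylSet p0 n) =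
        ∏ m ∈ Finset.range n,
          ((if (p0.1 m).2 = G.playFun σ (p0.1 m).1 then 1 else 0) *
            (if m + 1 < n then G.q (p0.1 m).1 (p0.1 m).2 ((p0.1 (m + 1)).1) else 1))

/-- Expected payoff of player `i` under the profile `σ`: the integral of `u i`
against the induced measure. -/
noncomputable def epay (μ : G.Profile → Measure G.Play) (u : N → G.Play → ℝ)
    (σ : G.Profile) (i : N) : ℝ :=
  ∫ p, u i p ∂(μ σ)

/-- Nash equilibrium: no player can improve his expected payoff by a unilateral
deviation. -/
def IsNash (μ : G.Profile → Measure G.Play) (u : N → G.Play → ℝ) (σ : G.Profile) : Prop :=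
  ∀ (i : N) (τi : G.Strat i), G.epay μ u (G.comb i τi σ) i ≤ G.epay μ u σ i

/-- Secure equilibrium: a Nash equilibrium such that no player `i` has a deviation
keeping his own expected payoff equal, making all opponents weakly worse off, and
making some opponent strictly worse off. -/
def IsSecure (μ : G.Profile → Measure G.Play) (u : N → G.Play → ℝ) (σ : G.Profile) : Prop :=
  G.IsNash μ u σ ∧
    ¬ ∃ (i : N) (τi : G.Strat i),
        G.epay μ u (G.comb i τi σ) i = G.epay μ u σ i ∧
        (∀ j : N, j ≠ i → G.epay μ u (G.comb i τi σ) j ≤ G.epay μ u σ j) ∧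
        (∃ k : N, k ≠ i ∧ G.epay μ u (G.comb i τi σ) k < G.epay μ u σ k)

end PGame

namespace PGame

section Aux

variable {N S A : Type*} (G : PGame N S A)

/-- A state determines the history leading to it. -/
lemma play_unique (p p' : G.Play) : ∀ (n k : ℕ), (p'.1 k).1 = (p.1 n).1 →
    k = n ∧ ∀ m < n, p'.1 m = p.1 m := by
  intro n
  induction n with
  | zero =>
    intro k hk
    cases k with
    | zero => exact ⟨rfl, fun m hm => absurd hm (Nat.not_lt_zero m)⟩
    | succ k =>
      exfalso
      have h := p'.2.2 k
      rw [hk, p.2.1] at h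
      exact G.init_not_succ _ _ h.1 h.2
  | succ n ih =>
    intro k hk
    cases k with
    | zero =>
      exfalso
      have h := p.2.2 n
      rw [← hk, p'.2.1] at h
      exact G.init_not_succ _ _ h.1 h.2
    | succ k =>
      have h := p.2.2 n
      have h' := p'.2.2 k
      rw [hk] at h'
      obtain ⟨h1, h2⟩ := G.unique_pred _ _ _ _ _ h'.1 h.1 h'.2 h.2
      obtain ⟨h3, h4⟩ := ih k h1
      subst h3
      refine ⟨rfl, fun m hm => ?_⟩
      rcases Nat.lt_succ_iff_lt_or_eq.1 hm with h5 | h5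
      · exact h4 m h5
      · subst h5
        exact Prod.ext h1 h2

/-- Some legal action. -/
noncomputable def someAct (s : S) : A := (G.act_nonempty s).choose

lemma someAct_mem (s : S) : G.someAct s ∈ G.act s := (G.act_nonempty s).choose_spec

/-- Some successor. -/
noncomputable def someSucc (s : S) (a : A) : S := (G.q s a).support_nonempty.choose

lemma someSucc_mem (s : S) (a : A) : G.someSucc s a ∈ (G.q s a).support :=
  (G.q s a).support_nonempty.choose_spec

/-- An arbitrary continuation from a state and an action. -/
noncomputable def path (s : S) (a : A) : ℕ → S × A
  | 0 => (s, a)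
  | k + 1 => (G.someSucc (path s a k).1 (path s a k).2,
      G.someAct (G.someSucc (path s a k).1 (path s a k).2))

lemma path_mem (s : S) (a : A) (ha : a ∈ G.act s) (k : ℕ) :
    (G.path s a k).2 ∈ G.act (G.path s a k).1 := by
  cases k with
  | zero => exact ha
  | succ k => exact G.someAct_mem _

lemma path_succ (s : S) (a : A) (k : ℕ) :
    (G.path s a (k + 1)).1 ∈ (G.q (G.path s a k).1 (G.path s a k).2).support :=
  G.someSucc_mem _ _

lemma exists_play_init (a : A) (ha : a ∈ G.act G.init) :
    ∃ p : G.Play, p.1 0 = (G.init, a) :=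
  ⟨⟨G.path G.init a, rfl, fun m => ⟨G.path_mem _ _ ha m, G.path_succ _ _ m⟩⟩, rfl⟩

lemma exists_play_step (p : G.Play) (n : ℕ) (s z : S) (a b : A) (hp : (p.1 n).1 = s)
    (ha : a ∈ G.act s) (hz : z ∈ (G.q s a).support) (hb : b ∈ G.act z) :
    ∃ p' : G.Play, p'.1 n = (s, a) ∧ p'.1 (n + 1) = (z, b) := by
  refine ⟨⟨fun m => if m < n then p.1 m else if m = n then (s, a) else
    G.path z b (m - (n + 1)), ?_, ?_⟩, by simp, by simp [path]⟩
  · rcases Nat.eq_zero_or_pos n with h | h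
    · subst h
      simpa using hp.symm.trans p.2.1
    · simpa [h] using p.2.1
  · intro m
    rcases lt_trichotomy m n with h | h | h
    · refine ⟨by simpa [h] using (p.2.2 m).1, ?_⟩
      by_cases h2 : m + 1 < n
      · simpa [h, h2] using (p.2.2 m).2
      · have h3 : m + 1 = n := by omega
        have := (p.2.2 m).2
        rw [h3, hp] at this
        simpa [h, h2, h3] using this
    · subst h
      refine ⟨by simpa using ha, by simpa [path] using hz⟩
    · obtain ⟨k, rfl⟩ : ∃ k, m = n + 1 + k := ⟨m - (n + 1), by omega⟩
      have e1 : ¬ (n + 1 + k < n) := by omega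
      have e2 : ¬ (n + 1 + k = n) := by omega
      have e3 : ¬ (n + 1 + k + 1 < n) := by omega
      have e4 : ¬ (n + 1 + k + 1 = n) := by omega
      have e5 : n + 1 + k - (n + 1) = k := by omega
      have e6 : n + 1 + k + 1 - (n + 1) = k + 1 := by omega
      simp only [e1, e2, e3, e4, e5, e6, if_false]
      exact ⟨G.path_mem _ _ hb k, G.path_succ _ _ k⟩

lemma exists_play_through (s : S) : ∃ (p : G.Play) (n : ℕ), (p.1 n).1 = s := by
  have h := G.reach s
  induction h with
  | refl =>
    obtain ⟨p, hp⟩ := G.exists_play_init _ (G.someAct_mem _)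
    exact ⟨p, 0, by rw [hp]⟩
  | tail _ h ih =>
    obtain ⟨p, n, hp⟩ := ih
    obtain ⟨a, ha, hz⟩ := h
    obtain ⟨p', _, h'⟩ := G.exists_play_step p n _ _ a _ hp ha hz (G.someAct_mem _)
    exact ⟨p', n + 1, by rw [h']⟩

/-- Payoffs of the plays through a state. -/
def pays (u : G.Play → ℝ) (s : S) : Set ℝ := { x | ∃ (p : G.Play) (n : ℕ), (p.1 n).1 = s ∧ u p = x }

/-- Smallest payoff after a state. -/
noncomputable def lo (u : G.Play → ℝ) (s : S) : ℝ := sInf (G.pays u s)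

/-- Largest payoff after a state. -/
noncomputable def hi (u : G.Play → ℝ) (s : S) : ℝ := sSup (G.pays u s)

lemma pays_nonempty (u : G.Play → ℝ) (s : S) : (G.pays u s).Nonempty := by
  obtain ⟨p, n, h⟩ := G.exists_play_through s
  exact ⟨_, p, n, h, rfl⟩

variable {u : G.Play → ℝ} {C : ℝ}

lemma pays_bddBelow (hC : ∀ p, |u p| ≤ C) (s : S) : BddBelow (G.pays u s) := by
  refine ⟨-C, ?_⟩
  rintro x ⟨p, n, -, rfl⟩
  exact (abs_le.1 (hC p)).1

lemma pays_bddAbove (hC : ∀ p, |u p| ≤ C) (s : S) : BddAbove (G.pays u s) := by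
  refine ⟨C, ?_⟩
  rintro x ⟨p, n, -, rfl⟩
  exact (abs_le.1 (hC p)).2

lemma lo_le_hi (hC : ∀ p, |u p| ≤ C) (s : S) : G.lo u s ≤ G.hi u s :=
  csInf_le_csSup (G.pays_nonempty u s) (G.pays_bddBelow hC s) (G.pays_bddAbove hC s) 

lemma neg_le_lo (hC : ∀ p, |u p| ≤ C) (s : S) : -C ≤ G.lo u s := by
  refine le_csInf (G.pays_nonempty u s) ?_
  rintro x ⟨p, n, -, rfl⟩
  exact (abs_le.1 (hC p)).1

lemma hi_le (hC : ∀ p, |u p| ≤ C) (s : S) : G.hi u s ≤ C := by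
  refine csSup_le (G.pays_nonempty u s) ?_
  rintro x ⟨p, n, -, rfl⟩
  exact (abs_le.1 (hC p)).2

lemma pays_succ (u : G.Play → ℝ) {s z : S} {a : A} (ha : a ∈ G.act s) (hz : z ∈ (G.q s a).support) :
    G.pays u z ⊆ G.pays u s := by
  rintro x ⟨p, n, h, rfl⟩
  cases n with
  | zero =>
    rw [p.2.1] at h
    subst h
    exact absurd hz (G.init_not_succ _ _ ha)
  | succ n =>
    have h' := p.2.2 n
    rw [h] at h'
    exact ⟨p, n, (G.unique_pred _ _ _ _ _ h'.1 ha h'.2 hz).1, rfl⟩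

lemma lo_succ (hC : ∀ p, |u p| ≤ C) {s z : S} {a : A} (ha : a ∈ G.act s) (hz : z ∈ (G.q s a).support) :
    G.lo u s ≤ G.lo u z :=
  csInf_le_csInf (G.pays_bddBelow hC s) (G.pays_nonempty u z) (G.pays_succ u ha hz)

lemma hi_succ (hC : ∀ p, |u p| ≤ C) {s z : S} {a : A} (ha : a ∈ G.act s) (hz : z ∈ (G.q s a).support) :
    G.hi u z ≤ G.hi u s :=
  csSup_le_csSup (G.pays_bddAbove hC s) (G.pays_nonempty u z) (G.pays_succ u ha hz)

/-- Continuity in terms of cylinders. -/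
lemma cont_cyl (hu : Continuous u) (p : G.Play) (ε : ℝ) (hε : 0 < ε) :
    ∃ n, ∀ p' ∈ G.cylSet p n, |u p' - u p| < ε := by
  let _ : TopologicalSpace S := ⊥
  let _ : TopologicalSpace A := ⊥
  have : DiscreteTopology S := ⟨rfl⟩
  have : DiscreteTopology A := ⟨rfl⟩
  have h1 : {p' : G.Play | |u p' - u p| < ε} ∈ nhds p := by
    have := hu.continuousAt (x := p)
    have := this (Metric.ball_mem_nhds (u p) hε)
    simpa [Set.preimage, Real.dist_eq] using this
  have h2 : {p' : { p : ℕ → S × A // G.IsPlay p } | |u p' - u p| < ε} ∈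
      nhds (⟨p.1, p.2⟩ : { p : ℕ → S × A // G.IsPlay p }) := h1
  rw [nhds_subtype_eq_comap, Filter.mem_comap] at h2
  obtain ⟨t, ht, hsub⟩ := h2
  rw [nhds_pi, Filter.mem_pi] at ht
  obtain ⟨I, hI, V, hV, hsub'⟩ := ht
  obtain ⟨n, hn⟩ := hI.bddAbove
  refine ⟨n + 1, fun p' hp' => ?_⟩
  refine hsub (a := ⟨p'.1, p'.2⟩) (hsub' ?_)
  intro i hi
  have : p'.1 i = p.1 i := hp' i (Nat.lt_succ_of_le (hn hi))
  show p'.1 i ∈ V i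
  rw [this]
  exact mem_of_mem_nhds (hV i)

/-- `h` lies between the smallest and the largest remaining payoff. -/
def Br (u : G.Play → ℝ) (h : S → ℝ) : Prop := ∀ s, G.lo u s ≤ h s ∧ h s ≤ G.hi u s

lemma Br.abs_le (hC : ∀ p, |u p| ≤ C) {h : S → ℝ} (hb : G.Br u h) (s : S) : |h s| ≤ C :=
  _root_.abs_le.2 ⟨(G.neg_le_lo hC s).trans (hb s).1, (hb s).2.trans (G.hi_le hC s)⟩

lemma Br.tendsto (hu : Continuous u) {h : S → ℝ} (hb : G.Br u h) (p : G.Play) :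
    Filter.Tendsto (fun n => h (p.1 n).1) Filter.atTop (nhds (u p)) := by
  rw [Metric.tendsto_atTop]
  intro ε hε
  obtain ⟨n, hn⟩ := G.cont_cyl hu p (ε / 2) (half_pos hε)
  refine ⟨n, fun k hk => ?_⟩
  have key : ∀ x ∈ G.pays u (p.1 k).1, |x - u p| < ε / 2 := by
    rintro x ⟨p', m, h1, rfl⟩
    obtain ⟨-, h2⟩ := G.play_unique p p' k m h1
    exact hn p' fun i hi => h2 i (hi.trans_le hk)
  have h1 : u p - ε / 2 ≤ G.lo u (p.1 k).1 := by
    refine le_csInf (G.pays_nonempty u _) fun x hx => ?_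
    linarith [(abs_lt.1 (key x hx)).1]
  have h2 : G.hi u (p.1 k).1 ≤ u p + ε / 2 := by
    refine csSup_le (G.pays_nonempty u _) fun x hx => ?_
    linarith [(abs_lt.1 (key x hx)).2]
  rw [Real.dist_eq, abs_lt]
  constructor <;> linarith [(hb (p.1 k).1).1, (hb (p.1 k).1).2]

end Aux

section Values

variable {N S A : Type*} (G : PGame N S A) [MeasurableSpace S] [DiscreteMeasurableSpace S]

/-- Expected value of `h` after action `a` in state `s`. -/
noncomputable def Q (h : S → ℝ) (s : S) (a : A) : ℝ := ∫ z, h z ∂(G.q s a).toMeasure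

lemma ae_support (s : S) (a : A) : ∀ᵐ z ∂(G.q s a).toMeasure, z ∈ (G.q s a).support := by
  rw [ae_iff]
  rw [PMF.toMeasure_apply_eq_zero_iff _ MeasurableSet.of_discrete]
  exact Set.disjoint_left.2 fun z h1 h2 => h2 h1

lemma integrable_of_bdd {T : Type*} [MeasurableSpace T] (ν : Measure T) [IsFiniteMeasure ν]
    {h : T → ℝ} (hm : Measurable h) {C : ℝ} (hC : ∀ z, |h z| ≤ C) : Integrable h ν :=
  Integrable.of_bound hm.aestronglyMeasurable C (Filter.Eventually.of_forall hC)

lemma Q_congr {h h' : S → ℝ} {s : S} {a : A} (H : ∀ z ∈ (G.q s a).support, h z = h' z) :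
    G.Q h s a = G.Q h' s a := by
  refine integral_congr_ae ?_
  filter_upwards [G.ae_support s a] with z hz using H z hz

lemma Q_mono {C : ℝ} {h h' : S → ℝ} (hh : ∀ z, |h z| ≤ C) (hh' : ∀ z, |h' z| ≤ C) {s : S} {a : A}
    (H : ∀ z ∈ (G.q s a).support, h z ≤ h' z) :
    G.Q h s a ≤ G.Q h' s a := by
  refine integral_mono_ae (integrable_of_bdd _ .of_discrete hh)
    (integrable_of_bdd _ .of_discrete hh') ?_
  filter_upwards [G.ae_support s a] with z hz using H z hz

lemma Q_eq_forall {C : ℝ} {h h' : S → ℝ} (hh : ∀ z, |h z| ≤ C) (hh' : ∀ z, |h' z| ≤ C) {s : S} {a : A}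
    (H : ∀ z ∈ (G.q s a).support, h z ≤ h' z) (he : G.Q h s a = G.Q h' s a) :
    ∀ z ∈ (G.q s a).support, h z = h' z := by
  have H1 : h ≤ᵐ[(G.q s a).toMeasure] h' := by
    filter_upwards [G.ae_support s a] with z hz using H z hz
  have H2 := (integral_eq_iff_of_ae_le (integrable_of_bdd _ .of_discrete hh)
    (integrable_of_bdd _ .of_discrete hh') H1).1 he
  have H3 : (G.q s a).toMeasure {z | ¬ h z = h' z} = 0 := ae_iff.1 H2
  rw [PMF.toMeasure_apply_eq_zero_iff _ MeasurableSet.of_discrete] at H3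
  intro z hz
  by_contra hne
  exact Set.disjoint_left.1 H3 hz hne

lemma Q_const (c : ℝ) (s : S) (a : A) : G.Q (fun _ => c) s a = c := by simp [Q]

lemma const_le_Q {C : ℝ} {h : S → ℝ} (hh : ∀ z, |h z| ≤ C) {s : S} {a : A} {c : ℝ}
    (H : ∀ z ∈ (G.q s a).support, c ≤ h z) : c ≤ G.Q h s a := by
  rw [← G.Q_const c s a]
  exact G.Q_mono (C := max C |c|) (fun _ => le_max_right _ _)
    (fun z => (hh z).trans (le_max_left _ _)) H

lemma Q_le_const {C : ℝ} {h : S → ℝ} (hh : ∀ z, |h z| ≤ C) {s : S} {a : A} {c : ℝ}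
    (H : ∀ z ∈ (G.q s a).support, h z ≤ c) : G.Q h s a ≤ c := by
  rw [← G.Q_const c s a]
  exact G.Q_mono (C := max C |c|) (fun z => (hh z).trans (le_max_left _ _))
    (fun _ => le_max_right _ _) H

/-- Fixed points of monotone operators on order intervals of functions. -/
lemma exists_fix (l r : S → ℝ) (hlr : ∀ s, l s ≤ r s) (T : (S → ℝ) → S → ℝ)
    (mono : ∀ h h' : S → ℝ, (∀ s, l s ≤ h s) → (∀ s, h s ≤ h' s) → (∀ s, h' s ≤ r s) →
      ∀ s, T h s ≤ T h' s)
    (hl : ∀ s, l s ≤ T l s) (hr : ∀ s, T r s ≤ r s) :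
    ∃ h : S → ℝ, (∀ s, l s ≤ h s) ∧ (∀ s, h s ≤ r s) ∧ ∀ s, T h s = h s := by
  let B : Set (S → ℝ) := {h | (∀ s, l s ≤ h s) ∧ (∀ s, h s ≤ r s) ∧ ∀ s, h s ≤ T h s}
  let v : S → ℝ := fun s => sSup ((fun h : S → ℝ => h s) '' B)
  have lB : l ∈ B := ⟨fun _ => le_rfl, hlr, hl⟩
  have bdd : ∀ s, BddAbove ((fun h : S → ℝ => h s) '' B) := by
    intro s
    refine ⟨r s, ?_⟩
    rintro x ⟨h, hh, rfl⟩
    exact hh.2.1 s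
  have le_v : ∀ h ∈ B, ∀ s, h s ≤ v s := fun h hh s => le_csSup (bdd s) ⟨h, hh, rfl⟩
  have v_le : ∀ s c, (∀ h ∈ B, h s ≤ c) → v s ≤ c := by
    intro s c hc
    refine csSup_le ⟨_, l, lB, rfl⟩ ?_
    rintro x ⟨h, hh, rfl⟩
    exact hc h hh
  have v1 : ∀ s, l s ≤ v s := le_v l lB
  have v2 : ∀ s, v s ≤ r s := fun s => v_le s _ fun h hh => hh.2.1 s
  have v3 : ∀ s, v s ≤ T v s := fun s => v_le s _ fun h hh =>
    (hh.2.2 s).trans (mono h v hh.1 (le_v h hh) v2 s)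
  have v4 : ∀ s, T v s ≤ r s := fun s => (mono v r v1 v2 (fun _ => le_rfl) s).trans (hr s)
  have v5 : T v ∈ B := ⟨fun s => (v1 s).trans (v3 s), v4, mono v (T v) v1 v3 v4⟩
  exact ⟨v, v1, v2, fun s => le_antisymm (le_v _ v5 s) (v3 s)⟩

/-- Bellman equations with restricted action sets. -/
lemma exists_bellman (P : S → Prop) (B : S → Finset A) (hB : ∀ s, (B s).Nonempty)
    (l r : S → ℝ) (C : ℝ) (hl : ∀ s, -C ≤ l s) (hr : ∀ s, r s ≤ C) (hlr : ∀ s, l s ≤ r s)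
    (Hl : ∀ s, ∀ a ∈ B s, l s ≤ G.Q l s a) (Hr : ∀ s, ∀ a ∈ B s, G.Q r s a ≤ r s) :
    ∃ h : S → ℝ, (∀ s, l s ≤ h s) ∧ (∀ s, h s ≤ r s) ∧ ∀ s,
      (P s → (∃ a ∈ B s, G.Q h s a = h s) ∧ ∀ a ∈ B s, G.Q h s a ≤ h s) ∧
      (¬ P s → (∃ a ∈ B s, G.Q h s a = h s) ∧ ∀ a ∈ B s, h s ≤ G.Q h s a) := by
  classical
  let T : (S → ℝ) → S → ℝ := fun h s =>
    if P s then (B s).sup' (hB s) (G.Q h s) else (B s).inf' (hB s) (G.Q h s)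
  have hbd : ∀ h : S → ℝ, (∀ s, l s ≤ h s) → (∀ s, h s ≤ r s) → ∀ s, |h s| ≤ C :=
    fun h h1 h2 s => abs_le.2 ⟨(hl s).trans (h1 s), (h2 s).trans (hr s)⟩
  obtain ⟨h, h1, h2, h3⟩ := exists_fix l r hlr T (by
    intro h h' a1 a2 a3 s
    have b1 := hbd h a1 (fun s => (a2 s).trans (a3 s))
    have b2 := hbd h' (fun s => (a1 s).trans (a2 s)) a3
    have key : ∀ a, G.Q h s a ≤ G.Q h' s a := fun a => G.Q_mono b1 b2 fun z _ => a2 z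
    by_cases hP : P s
    · simp only [T, hP, if_true]
      exact Finset.sup'_mono_fun fun a _ => key a
    · simp only [T, hP, if_false]
      exact Finset.inf'_mono_fun fun a _ => key a) (by
    intro s
    by_cases hP : P s
    · simp only [T, hP, if_true]
      obtain ⟨a, ha⟩ := hB s
      exact Finset.le_sup'_of_le _ ha (Hl s a ha)
    · simp only [T, hP, if_false]
      exact Finset.le_inf' _ _ fun a ha => Hl s a ha) (by
    intro s
    by_cases hP : P s
    · simp only [T, hP, if_true]
      exact Finset.sup'_le _ _ fun a ha => Hr s a ha
    · simp only [T, hP, if_false]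
      obtain ⟨a, ha⟩ := hB s
      exact Finset.inf'_le_of_le _ ha (Hr s a ha))
  refine ⟨h, h1, h2, fun s => ⟨fun hP => ?_, fun hP => ?_⟩⟩
  · have h4 := h3 s
    simp only [T, hP, if_true] at h4
    obtain ⟨a, ha, he⟩ := Finset.exists_mem_eq_sup' (hB s) (G.Q h s)
    exact ⟨⟨a, ha, he.symm.trans h4⟩, fun b hb => (Finset.le_sup' (G.Q h s) hb).trans h4.le⟩
  · have h4 := h3 s
    simp only [T, hP, if_false] at h4
    obtain ⟨a, ha, he⟩ := Finset.exists_mem_eq_inf' (hB s) (G.Q h s)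
    exact ⟨⟨a, ha, he.symm.trans h4⟩, fun b hb => h4.ge.trans (Finset.inf'_le (G.Q h s) hb)⟩

lemma lo_le_Q {u : G.Play → ℝ} {C : ℝ} (hC : ∀ p, |u p| ≤ C) {s : S} {a : A} (ha : a ∈ G.act s) :
    G.lo u s ≤ G.Q (G.lo u) s a :=
  G.const_le_Q (C := C) (Br.abs_le G hC fun s => ⟨le_rfl, G.lo_le_hi hC s⟩)
    fun _ hz => G.lo_succ hC ha hz

lemma Q_le_hi {u : G.Play → ℝ} {C : ℝ} (hC : ∀ p, |u p| ≤ C) {s : S} {a : A} (ha : a ∈ G.act s) :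
    G.Q (G.hi u) s a ≤ G.hi u s :=
  G.Q_le_const (C := C) (Br.abs_le G hC fun s => ⟨G.lo_le_hi hC s, le_rfl⟩)
    fun _ hz => G.hi_succ hC ha hz

/-- Lexicographic values of the zero-sum games, player `i` against the others. -/
lemma exists_lex (i : N) (u y : G.Play → ℝ) (C : ℝ) (hu : ∀ p, |u p| ≤ C) (hy : ∀ p, |y p| ≤ C) :
    ∃ (v w : S → ℝ) (b : S → A), G.Br u v ∧ G.Br y w ∧ ∀ s, b s ∈ G.act s ∧
      G.Q v s (b s) = v s ∧ G.Q w s (b s) = w s ∧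
      (G.ctrl s = i → ∀ a ∈ G.act s, G.Q v s a ≤ v s ∧ (G.Q v s a = v s → G.Q w s a ≤ w s)) ∧
      (G.ctrl s ≠ i → ∀ a ∈ G.act s, v s ≤ G.Q v s a ∧ (G.Q v s a = v s → w s ≤ G.Q w s a)) := by
  classical
  obtain ⟨v, v1, v2, v3⟩ := G.exists_bellman (fun s => G.ctrl s = i) G.act G.act_nonempty
    (G.lo u) (G.hi u) C (G.neg_le_lo hu) (G.hi_le hu) (G.lo_le_hi hu)
    (fun s a ha => G.lo_le_Q hu ha) (fun s a ha => G.Q_le_hi hu ha)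
  obtain ⟨w, w1, w2, w3⟩ := G.exists_bellman (fun s => G.ctrl s = i)
    (fun s => (G.act s).filter fun a => G.Q v s a = v s) (by
      intro s
      have : ∃ a ∈ G.act s, G.Q v s a = v s := by
        by_cases h : G.ctrl s = i
        · exact ((v3 s).1 h).1
        · exact ((v3 s).2 h).1
      obtain ⟨a, ha, he⟩ := this
      exact ⟨a, Finset.mem_filter.2 ⟨ha, he⟩⟩)
    (G.lo y) (G.hi y) C (G.neg_le_lo hy) (G.hi_le hy) (G.lo_le_hi hy)
    (fun s a ha => G.lo_le_Q hy (Finset.mem_filter.1 ha).1)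
    (fun s a ha => G.Q_le_hi hy (Finset.mem_filter.1 ha).1)
  have hb : ∀ s, ∃ a, (a ∈ G.act s ∧ G.Q v s a = v s) ∧ G.Q w s a = w s := by
    intro s
    have : ∃ a ∈ (G.act s).filter fun a => G.Q v s a = v s, G.Q w s a = w s := by
      by_cases h : G.ctrl s = i
      · exact ((w3 s).1 h).1
      · exact ((w3 s).2 h).1
    obtain ⟨a, ha, he⟩ := this
    exact ⟨a, Finset.mem_filter.1 ha, he⟩
  choose b hb using hb
  refine ⟨v, w, b, fun s => ⟨v1 s, v2 s⟩, fun s => ⟨w1 s, w2 s⟩, fun s =>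
    ⟨(hb s).1.1, (hb s).1.2, (hb s).2, fun h a ha => ⟨((v3 s).1 h).2 a ha, fun he =>
      ((w3 s).1 h).2 a (Finset.mem_filter.2 ⟨ha, he⟩)⟩, fun h a ha => ⟨((v3 s).2 h).2 a ha, fun he =>
      ((w3 s).2 h).2 a (Finset.mem_filter.2 ⟨ha, he⟩)⟩⟩⟩

/-- Continuation payoffs of a selector that never decreases the lexicographic value. -/
lemma exists_cont (u y : G.Play → ℝ) (C : ℝ) (hu : ∀ p, |u p| ≤ C) (hy : ∀ p, |y p| ≤ C)
    (v w : S → ℝ) (hv : G.Br u v) (hw : G.Br y w) (f : S → A) (hf : ∀ s, f s ∈ G.act s)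
    (h1 : ∀ s, v s ≤ G.Q v s (f s)) (h2 : ∀ s, G.Q v s (f s) = v s → w s ≤ G.Q w s (f s)) :
    ∃ U Y : S → ℝ, G.Br u U ∧ G.Br y Y ∧ (∀ s, G.Q U s (f s) = U s) ∧ (∀ s, G.Q Y s (f s) = Y s) ∧
      ∀ s, v s ≤ U s ∧ (v s = U s → w s ≤ Y s) := by
  classical
  obtain ⟨U, U1, U2, U3⟩ := G.exists_bellman (fun _ => True) (fun s => {f s}) (by simp)
    v (G.hi u) C (fun s => (G.neg_le_lo hu s).trans (hv s).1) (G.hi_le hu) (fun s => (hv s).2)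
    (by simpa using h1) (by simpa using fun s => G.Q_le_hi hu (hf s))
  have U4 : ∀ s, G.Q U s (f s) = U s := by simpa using fun s => ((U3 s).1 trivial).1
  have UB : G.Br u U := fun s => ⟨(hv s).1.trans (U1 s), U2 s⟩
  have key : ∀ s, v s = U s → G.Q v s (f s) = v s ∧ ∀ z ∈ (G.q s (f s)).support, v z = U z := by
    intro s hs
    have e1 : G.Q v s (f s) ≤ G.Q U s (f s) :=
      G.Q_mono (Br.abs_le G hu hv) (Br.abs_le G hu UB) fun z _ => U1 z
    have e2 := h1 s
    have e3 := U4 s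
    refine ⟨by linarith, ?_⟩
    exact G.Q_eq_forall (Br.abs_le G hu hv) (Br.abs_le G hu UB) (fun z _ => U1 z) (by linarith)
  let l : S → ℝ := fun s => if v s = U s then w s else G.lo y s
  have lB : G.Br y l := by
    intro s
    by_cases h : v s = U s
    · simpa [l, h] using hw s
    · simpa [l, h] using G.lo_le_hi hy s
  obtain ⟨Y, Y1, Y2, Y3⟩ := G.exists_bellman (fun _ => True) (fun s => {f s}) (by simp)
    l (G.hi y) C (fun s => (G.neg_le_lo hy s).trans (lB s).1) (G.hi_le hy) (fun s => (lB s).2)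
    (by
      intro s a ha
      rw [Finset.mem_singleton] at ha
      subst ha
      by_cases h : v s = U s
      · obtain ⟨k1, k2⟩ := key s h
        have e : G.Q l s (f s) = G.Q w s (f s) := G.Q_congr fun z hz => by simp [l, k2 z hz]
        rw [e]
        simpa [l, h] using h2 s k1
      · have e : l s = G.lo y s := by simp [l, h]
        rw [e]
        exact G.const_le_Q (Br.abs_le G hy lB) fun z hz =>
          (G.lo_succ hy (hf s) hz).trans (lB z).1)
    (by simpa using fun s => G.Q_le_hi hy (hf s))
  refine ⟨U, Y, UB, fun s => ⟨(lB s).1.trans (Y1 s), Y2 s⟩, U4,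
    by simpa using fun s => ((Y3 s).1 trivial).1, fun s => ⟨U1 s, fun h => ?_⟩⟩
  have := Y1 s
  simpa [l, h] using this

end Values

section Meas

variable {N S A : Type*} (G : PGame N S A)

instance : BorelSpace G.Play := ⟨rfl⟩

lemma measurable_state [MeasurableSpace S] [DiscreteMeasurableSpace S] (n : ℕ) :
    Measurable fun p : G.Play => (p.1 n).1 := by
  intro t _
  refine IsOpen.measurableSet ?_
  let _ : TopologicalSpace S := ⊥
  let _ : TopologicalSpace A := ⊥
  have : DiscreteTopology S := ⟨rfl⟩
  have h : Continuous fun p : { p : ℕ → S × A // G.IsPlay p } => (p.1 n).1 :=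
    continuous_fst.comp ((continuous_apply n).comp continuous_subtype_val)
  exact (isOpen_discrete t).preimage h

lemma playFun_mem (σ : G.Profile) (s : S) : G.playFun σ s ∈ G.act s := (σ (G.ctrl s)).2 s rfl

variable {μ : G.Profile → Measure G.Play}

lemma cylSet_eq (p0 : G.Play) (n : ℕ) (x : S × A) (h : p0.1 n = x) :
    {p : G.Play | p.1 n = x} = G.cylSet p0 (n + 1) := by
  ext p
  constructor
  · intro hp m hm
    have hp' : p.1 n = p0.1 n := Eq.trans hp h.symm
    rcases Nat.lt_succ_iff_lt_or_eq.1 hm with h5 | h5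
    · exact (G.play_unique p0 p n n (by rw [hp'])).2 m h5
    · rw [h5]
      exact hp'
  · intro hp
    exact (hp n (Nat.lt_succ_self n)).trans h

lemma cyl_succ (hμ : G.IsInducedMeasure μ) (σ : G.Profile) (p0 : G.Play) (n : ℕ) (h1 : (p0.1 n).2 = G.playFun σ (p0.1 n).1)
    (h2 : (p0.1 (n + 1)).2 = G.playFun σ (p0.1 (n + 1)).1) :
    μ σ (G.cylSet p0 (n + 1 + 1)) = G.q (p0.1 n).1 (p0.1 n).2 ((p0.1 (n + 1)).1) *
      μ σ (G.cylSet p0 (n + 1)) := by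
  rw [hμ.2 σ p0, hμ.2 σ p0, Finset.prod_range_succ, Finset.prod_range_succ, Finset.prod_range_succ]
  rw [if_pos h1, if_pos h2]
  have : ∀ m ∈ Finset.range n, m + 1 < n + 1 + 1 ∧ m + 1 < n + 1 := by
    intro m hm
    have := Finset.mem_range.1 hm
    omega
  rw [mul_comm (G.q (p0.1 n).1 (p0.1 n).2 ((p0.1 (n + 1)).1))]
  simp only [lt_irrefl, if_false, mul_one, one_mul, Nat.lt_succ_self, if_true]
  congr 1
  refine Finset.prod_congr rfl fun m hm => ?_
  rw [if_pos (this m hm).1, if_pos (this m hm).2]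

lemma ae_follow (hμ : G.IsInducedMeasure μ) (σ : G.Profile) [Countable S] : ∀ᵐ p ∂(μ σ), ∀ n, (p.1 n).2 = G.playFun σ (p.1 n).1 := by
  rw [ae_all_iff]
  intro n
  rw [ae_iff]
  have hsub : {p : G.Play | ¬ (p.1 n).2 = G.playFun σ (p.1 n).1} ⊆
      ⋃ (s : S), ⋃ a ∈ {a ∈ (G.act s : Set A) | a ≠ G.playFun σ s}, {p : G.Play | p.1 n = (s, a)} := by
    intro p hp
    simp only [Set.mem_iUnion]
    exact ⟨(p.1 n).1, (p.1 n).2, ⟨(p.2.2 n).1, hp⟩, rfl⟩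
  refine measure_mono_null hsub ?_
  rw [measure_iUnion_null_iff]
  intro s
  rw [measure_biUnion_null_iff (((G.act s).finite_toSet.subset (Set.sep_subset _ _)).countable)]
  rintro a ⟨-, ha⟩
  rcases Set.eq_empty_or_nonempty {p : G.Play | p.1 n = (s, a)} with h | ⟨p0, hp0⟩
  · rw [h, measure_empty]
  · rw [G.cylSet_eq p0 n _ hp0, hμ.2 σ p0]
    refine Finset.prod_eq_zero (Finset.mem_range.2 (Nat.lt_succ_self n)) ?_
    have hp0' : p0.1 n = (s, a) := hp0
    rw [hp0']
    simp [ha]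

variable [Countable S] [MeasurableSpace S] [DiscreteMeasurableSpace S]

/-- Law of the `n`-th state. -/
noncomputable def law (μ : G.Profile → Measure G.Play) (σ : G.Profile) (n : ℕ) : Measure S :=
  (μ σ).map fun p : G.Play => (p.1 n).1

lemma law_singleton (hμ : G.IsInducedMeasure μ) (σ : G.Profile) (n : ℕ) (s : S) :
    G.law μ σ n {s} = μ σ {p : G.Play | p.1 n = (s, G.playFun σ s)} := by
  rw [law, Measure.map_apply (G.measurable_state n) MeasurableSet.of_discrete]
  refine measure_congr ?_
  filter_upwards [G.ae_follow hμ σ] with p hp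
  refine propext ⟨fun h => ?_, fun h => ?_⟩
  · have h' : (p.1 n).1 = s := h
    exact Prod.ext h' (by rw [hp n, h'])
  · exact congrArg Prod.fst (show p.1 n = _ from h)

lemma law_succ (hμ : G.IsInducedMeasure μ) (σ : G.Profile) (n : ℕ) : G.law μ σ (n + 1) =
    (G.law μ σ n).bind fun s => (G.q s (G.playFun σ s)).toMeasure := by
  refine Measure.ext_of_singleton fun z => ?_
  rw [Measure.bind_apply MeasurableSet.of_discrete Measurable.of_discrete.aemeasurable,
    lintegral_countable']
  simp only [PMF.toMeasure_apply_singleton _ _ (MeasurableSet.singleton _)]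
  by_cases hex : ∃ p0 : G.Play, p0.1 (n + 1) = (z, G.playFun σ z) ∧
      (p0.1 n).2 = G.playFun σ (p0.1 n).1
  · obtain ⟨p0, h1, h2⟩ := hex
    rw [tsum_eq_single (p0.1 n).1]
    · rw [G.law_singleton hμ, G.law_singleton hμ, G.cylSet_eq p0 (n + 1) _ h1,
        G.cylSet_eq p0 n ((p0.1 n).1, G.playFun σ (p0.1 n).1) (Prod.ext rfl h2),
        G.cyl_succ hμ σ p0 n h2 (by rw [h1]), h2, h1]
    · intro s hs
      have : G.q s (G.playFun σ s) z = 0 := by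
        by_contra hne
        have hz : z ∈ (G.q s (G.playFun σ s)).support := hne
        have h3 := p0.2.2 n
        rw [h1] at h3
        exact hs (G.unique_pred z _ _ _ _ (G.playFun_mem σ s) h3.1 hz h3.2).1
      rw [this, zero_mul]
  · have hL : G.law μ σ (n + 1) {z} = 0 := by
      rw [G.law_singleton hμ]
      refine measure_mono_null (t := {p | ¬ ∀ n, (p.1 n).2 = G.playFun σ (p.1 n).1}) ?_
        (ae_iff.1 (G.ae_follow hμ σ))
      intro p hp hall
      exact hex ⟨p, hp, hall n⟩
    rw [hL, eq_comm, ENNReal.tsum_eq_zero]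
    intro s
    by_contra hne
    rw [mul_eq_zero, not_or] at hne
    obtain ⟨h1, h2⟩ := hne
    rw [G.law_singleton hμ] at h2
    obtain ⟨p, hp⟩ := nonempty_of_measure_ne_zero h2
    have hp' : p.1 n = (s, G.playFun σ s) := hp
    obtain ⟨p', e1, e2⟩ := G.exists_play_step p n s z _ _ (by rw [hp']) (G.playFun_mem σ s) h1
      (G.playFun_mem σ z)
    exact hex ⟨p', e2, by rw [e1]⟩

lemma integral_step (hμ : G.IsInducedMeasure μ) (σ : G.Profile) {h : S → ℝ} {C : ℝ} (hC : ∀ s, |h s| ≤ C) (n : ℕ) :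
    ∫ p, h (p.1 (n + 1)).1 ∂(μ σ) =
      ∫ p, G.Q h (p.1 n).1 (G.playFun σ (p.1 n).1) ∂(μ σ) := by
  have := hμ.1 σ
  let κ : ProbabilityTheory.Kernel S S :=
    ⟨fun s => (G.q s (G.playFun σ s)).toMeasure, Measurable.of_discrete⟩
  let ν : ProbabilityTheory.Kernel Unit S := ProbabilityTheory.Kernel.const Unit (G.law μ σ n)
  have e1 : ∫ p, h (p.1 (n + 1)).1 ∂(μ σ) = ∫ s, h s ∂(G.law μ σ (n + 1)) := by
    rw [law, integral_map (G.measurable_state _).aemeasurable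
      Measurable.of_discrete.aestronglyMeasurable]
  have e2 : ∫ p, G.Q h (p.1 n).1 (G.playFun σ (p.1 n).1) ∂(μ σ) =
      ∫ s, G.Q h s (G.playFun σ s) ∂(G.law μ σ n) := by
    rw [law, integral_map (G.measurable_state _).aemeasurable
      Measurable.of_discrete.aestronglyMeasurable]
  have : IsProbabilityMeasure (G.law μ σ (n + 1)) :=
    Measure.isProbabilityMeasure_map (G.measurable_state _).aemeasurable
  have e3 : (κ.comp ν) () = G.law μ σ (n + 1) := by
    rw [G.law_succ hμ σ n, ProbabilityTheory.Kernel.comp_apply]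
    rfl
  have e4 := ProbabilityTheory.Kernel.integral_comp (η := κ) (κ := ν) (a := ()) (f := h)
    (by rw [e3]; exact integrable_of_bdd _ .of_discrete hC)
  rw [e1, e2, ← e3, e4]
  rfl

/-- Supermartingale lemma. -/
lemma super (hμ : G.IsInducedMeasure μ) (σ : G.Profile) {u : G.Play → ℝ} (hu : Continuous u) {C : ℝ} (hC : ∀ p, |u p| ≤ C) {h : S → ℝ}
    (hb : G.Br u h)
    (H : ∀ᵐ p ∂(μ σ), ∀ n, G.Q h (p.1 n).1 (G.playFun σ (p.1 n).1) ≤ h (p.1 n).1) :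
    ∫ p, u p ∂(μ σ) ≤ h G.init ∧ (∫ p, u p ∂(μ σ) = h G.init →
      ∀ᵐ p ∂(μ σ), ∀ n, G.Q h (p.1 n).1 (G.playFun σ (p.1 n).1) = h (p.1 n).1) := by
  have := hμ.1 σ
  have hbd := Br.abs_le G hC hb
  let E : ℕ → ℝ := fun n => ∫ p, h (p.1 n).1 ∂(μ σ)
  have meas : ∀ (k : S → ℝ) (n : ℕ), Measurable fun p : G.Play => k (p.1 n).1 := fun k n =>
    (Measurable.of_discrete (f := k)).comp (G.measurable_state n)
  have int1 : ∀ n, Integrable (fun p : G.Play => h (p.1 n).1) (μ σ) := fun n =>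
    integrable_of_bdd _ (meas h n) fun p => hbd _
  have int2 : ∀ n, Integrable (fun p : G.Play => G.Q h (p.1 n).1 (G.playFun σ (p.1 n).1)) (μ σ) :=
    fun n => integrable_of_bdd (C := C) _ (meas (fun s => G.Q h s (G.playFun σ s)) n) fun p =>
      abs_le.2 ⟨G.const_le_Q hbd fun z _ => (abs_le.1 (hbd z)).1,
        G.Q_le_const hbd fun z _ => (abs_le.1 (hbd z)).2⟩
  have lim : Filter.Tendsto E Filter.atTop (nhds (∫ p, u p ∂(μ σ))) := by
    refine tendsto_integral_of_dominated_convergence (fun _ => C)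
      (fun n => (meas h n).aestronglyMeasurable) (integrable_const C)
      (fun n => Filter.Eventually.of_forall fun p => hbd _)
      (Filter.Eventually.of_forall fun p => Br.tendsto G hu hb p)
  have E0 : E 0 = h G.init := by
    have : ∀ p : G.Play, h (p.1 0).1 = h G.init := fun p => by rw [p.2.1]
    simp [E, this]
  have anti : Antitone E := by
    refine antitone_nat_of_succ_le fun n => ?_
    show ∫ p, h (p.1 (n + 1)).1 ∂(μ σ) ≤ ∫ p, h (p.1 n).1 ∂(μ σ)
    rw [G.integral_step hμ σ hbd n]
    refine integral_mono_ae (int2 n) (int1 n) ?_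
    filter_upwards [H] with p hp using hp n
  have le : ∀ n, ∫ p, u p ∂(μ σ) ≤ E n := fun n => anti.le_of_tendsto lim n
  refine ⟨E0 ▸ le 0, fun he => ?_⟩
  have Ec : ∀ n, E n = h G.init := fun n =>
    le_antisymm (E0 ▸ anti (Nat.zero_le n)) (he ▸ le n)
  rw [ae_all_iff]
  intro n
  refine (integral_eq_iff_of_ae_le (int2 n) (int1 n) ?_).1 ?_
  · filter_upwards [H] with p hp using hp n
  · rw [← G.integral_step hμ σ hbd n]
    exact (Ec (n + 1)).trans (Ec n).symm

/-- Martingale lemma. -/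
lemma mart (hμ : G.IsInducedMeasure μ) (σ : G.Profile) {u : G.Play → ℝ} (hu : Continuous u) {C : ℝ} (hC : ∀ p, |u p| ≤ C) {h : S → ℝ}
    (hb : G.Br u h)
    (H : ∀ᵐ p ∂(μ σ), ∀ n, G.Q h (p.1 n).1 (G.playFun σ (p.1 n).1) = h (p.1 n).1) :
    ∫ p, u p ∂(μ σ) = h G.init := by
  have := hμ.1 σ
  have hbd := Br.abs_le G hC hb
  have meas : ∀ (k : S → ℝ) (n : ℕ), Measurable fun p : G.Play => k (p.1 n).1 := fun k n =>
    (Measurable.of_discrete (f := k)).comp (G.measurable_state n)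
  have lim : Filter.Tendsto (fun n => ∫ p, h (p.1 n).1 ∂(μ σ)) Filter.atTop
      (nhds (∫ p, u p ∂(μ σ))) := by
    refine tendsto_integral_of_dominated_convergence (fun _ => C)
      (fun n => (meas h n).aestronglyMeasurable) (integrable_const C)
      (fun n => Filter.Eventually.of_forall fun p => hbd _)
      (Filter.Eventually.of_forall fun p => Br.tendsto G hu hb p)
  have Ec : ∀ n, ∫ p, h (p.1 n).1 ∂(μ σ) = h G.init := by
    intro n
    induction n with
    | zero =>
      have : ∀ p : G.Play, h (p.1 0).1 = h G.init := fun p => by rw [p.2.1]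
      simp [this]
    | succ n ih =>
      rw [G.integral_step hμ σ hbd n, ← ih]
      refine integral_congr_ae ?_
      filter_upwards [H] with p hp using hp n
  simp only [Ec] at lim
  exact tendsto_nhds_unique lim tendsto_const_nhds

end Meas

section Main

variable {N S A : Type*} (G : PGame N S A)

/-- States reached when `f` is followed. -/
inductive OnPath (f : S → A) : S → Prop
  | init : OnPath f G.init
  | step (s z : S) : OnPath f s → z ∈ (G.q s (f s)).support → OnPath f z

/-- States at which player `i` was the first to deviate from `f`. -/
inductive Dev (f : S → A) (i : N) : S → Prop
  | first (s z : S) (a : A) : G.OnPath f s → G.ctrl s = i → a ∈ G.act s → a ≠ f s →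
      z ∈ (G.q s a).support → Dev f i z
  | step (s z : S) (a : A) : Dev f i s → a ∈ G.act s → z ∈ (G.q s a).support → Dev f i z

variable {G}

lemma OnPath.pred {f : S → A} (hf : ∀ s, f s ∈ G.act s) {s z : S} {a : A} (h : G.OnPath f z)
    (ha : a ∈ G.act s) (hz : z ∈ (G.q s a).support) : G.OnPath f s ∧ a = f s := by
  cases h with
  | init => exact absurd hz (G.init_not_succ _ _ ha)
  | step s' _ h1 h2 =>
    obtain ⟨rfl, rfl⟩ := G.unique_pred z _ _ _ _ ha (hf s') hz h2
    exact ⟨h1, rfl⟩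

lemma Dev.not_onPath {f : S → A} (hf : ∀ s, f s ∈ G.act s) {i : N} {z : S} (h : G.Dev f i z) :
    ¬ G.OnPath f z := by
  induction h with
  | first s z a h1 h2 h3 h4 h5 => exact fun h => h4 (h.pred hf h3 h5).2
  | step s z a h1 h2 h3 ih => exact fun h => ih (h.pred hf h2 h3).1

lemma Dev.unique {f : S → A} (hf : ∀ s, f s ∈ G.act s) {i j : N} {z : S} (h : G.Dev f i z)
    (h' : G.Dev f j z) : i = j := by
  induction h with
  | first s z a h1 h2 h3 h4 h5 =>
    cases h' with
    | first s' _ a' g1 g2 g3 g4 g5 =>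
      obtain ⟨rfl, rfl⟩ := G.unique_pred z _ _ _ _ h3 g3 h5 g5
      exact h2.symm.trans g2
    | step s' _ a' g1 g2 g3 =>
      obtain ⟨rfl, rfl⟩ := G.unique_pred z _ _ _ _ h3 g2 h5 g3
      exact absurd h1 (g1.not_onPath hf)
  | step s z a h1 h2 h3 ih =>
    cases h' with
    | first s' _ a' g1 g2 g3 g4 g5 =>
      obtain ⟨rfl, rfl⟩ := G.unique_pred z _ _ _ _ h2 g3 h3 g5
      exact absurd g1 (h1.not_onPath hf)
    | step s' _ a' g1 g2 g3 =>
      obtain ⟨rfl, rfl⟩ := G.unique_pred z _ _ _ _ h2 g2 h3 g3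
      exact ih g1

/-- A selector as a profile. -/
def ofSel (g : S → A) (hg : ∀ s, g s ∈ G.act s) : G.Profile := fun _ => ⟨g, fun s _ => hg s⟩

lemma playFun_comb (σ : G.Profile) (i : N) (τ : G.Strat i) (s : S) (hs : G.ctrl s ≠ i) :
    G.playFun (G.comb i τ σ) s = G.playFun σ s := by
  let _ := Classical.decEq N
  have h : G.comb i τ σ (G.ctrl s) = σ (G.ctrl s) := Function.update_of_ne hs τ σ
  unfold playFun
  rw [h]

theorem main_aux [Fintype N] [Countable S] (u : N → G.Play → ℝ)
    (hu_bdd : ∀ i : N, ∃ C : ℝ, ∀ p : G.Play, |u i p| ≤ C)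
    (hu_cont : ∀ i : N, Continuous (u i))
    (μ : G.Profile → Measure G.Play) (hμ : G.IsInducedMeasure μ) :
    ∃ σ : G.Profile, G.IsSecure μ u σ := by
  classical
  let _ : MeasurableSpace S := ⊤
  have : DiscreteMeasurableSpace S := ⟨fun _ => trivial⟩
  choose B hB using hu_bdd
  let y : N → G.Play → ℝ := fun i p => -∑ j ∈ Finset.univ.erase i, u j p
  let C : ℝ := ∑ j, B j
  obtain ⟨p₁⟩ : Nonempty G.Play := ⟨(G.exists_play_through G.init).choose⟩
  have B0 : ∀ i, 0 ≤ B i := fun i => (abs_nonneg _).trans (hB i p₁)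
  have uC : ∀ i p, |u i p| ≤ C := fun i p =>
    (hB i p).trans (Finset.single_le_sum (fun j _ => B0 j) (Finset.mem_univ i))
  have yC : ∀ i p, |y i p| ≤ C := by
    intro i p
    simp only [y, abs_neg]
    refine (Finset.abs_sum_le_sum_abs _ _).trans ((Finset.sum_le_sum fun j _ => hB j p).trans ?_)
    exact Finset.sum_le_sum_of_subset_of_nonneg (Finset.erase_subset _ _) fun j _ _ => B0 j
  have y_cont : ∀ i, Continuous (y i) := fun i =>
    (continuous_finsetSum _ fun j _ => hu_cont j).neg
  have lex := fun i => G.exists_lex i (u i) (y i) C (uC i) (yC i)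
  choose v w b hv hw hb using lex
  let f : S → A := fun s => b (G.ctrl s) s
  have hf : ∀ s, f s ∈ G.act s := fun s => (hb _ s).1
  have cont := fun i => G.exists_cont (u i) (y i) C (uC i) (yC i) (v i) (w i) (hv i) (hw i) f hf
    (by
      intro s
      by_cases h : G.ctrl s = i
      · subst h
        exact (hb _ s).2.1.ge
      · exact ((hb i s).2.2.2.2 h (f s) (hf s)).1)
    (by
      intro s he
      by_cases h : G.ctrl s = i
      · subst h
        exact (hb _ s).2.2.1.ge
      · exact ((hb i s).2.2.2.2 h (f s) (hf s)).2 he)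
  choose U Y hU hY U1 Y1 UY using cont
  let g : S → A := fun s => if h : ∃ i, G.Dev f i s then b h.choose s else f s
  have hg : ∀ s, g s ∈ G.act s := by
    intro s
    by_cases h : ∃ i, G.Dev f i s
    · simp only [g, h, dif_pos]
      exact (hb _ s).1
    · simp only [g, h, dif_neg, not_false_eq_true]
      exact hf s
  have g_on : ∀ s, G.OnPath f s → g s = f s := by
    intro s hs
    have h : ¬ ∃ i, G.Dev f i s := fun ⟨i, hi⟩ => hi.not_onPath hf hs
    simp only [g, h, dif_neg, not_false_eq_true]
  have g_dev : ∀ i s, G.Dev f i s → g s = b i s := by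
    intro i s hs
    have h : ∃ i, G.Dev f i s := ⟨i, hs⟩
    have e : h.choose = i := h.choose_spec.unique hf hs
    simp only [g, h, dif_pos, e]
  let σ : G.Profile := ofSel g hg
  have σg : ∀ s, G.playFun σ s = g s := fun s => rfl
  have init_nd : ∀ i, ¬ G.Dev f i G.init := fun i h => h.not_onPath hf OnPath.init
  -- payoffs of the equilibrium
  have on_all : ∀ᵐ p ∂(μ σ), ∀ n, G.OnPath f (p.1 n).1 := by
    filter_upwards [G.ae_follow hμ σ] with p hp n
    induction n with
    | zero => rw [p.2.1]; exact OnPath.init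
    | succ n ih =>
      refine OnPath.step _ _ ih ?_
      rw [← g_on _ ih, ← σg, ← hp n]
      exact (p.2.2 n).2
  have eqU : ∀ i, ∫ p, u i p ∂(μ σ) = U i G.init := by
    intro i
    refine G.mart hμ σ (hu_cont i) (uC i) (hU i) ?_
    filter_upwards [on_all] with p hp n
    rw [σg, g_on _ (hp n), U1]
  have eqY : ∀ i, ∫ p, y i p ∂(μ σ) = Y i G.init := by
    intro i
    refine G.mart hμ σ (y_cont i) (yC i) (hY i) ?_
    filter_upwards [on_all] with p hp n
    rw [σg, g_on _ (hp n), Y1]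
  -- deviations
  have dev : ∀ i (τ : G.Strat i), ∫ p, u i p ∂(μ (G.comb i τ σ)) ≤ U i G.init ∧
      (∫ p, u i p ∂(μ (G.comb i τ σ)) = U i G.init →
        ∫ p, y i p ∂(μ (G.comb i τ σ)) ≤ Y i G.init) := by
    intro i τ
    set ρ := G.comb i τ σ with hρ
    have ρg : ∀ s, G.ctrl s ≠ i → G.playFun ρ s = g s := fun s hs =>
      (playFun_comb σ i τ s hs).trans (σg s)
    have ρm := G.playFun_mem ρ
    have cases_all : ∀ᵐ p ∂(μ ρ), ∀ n, G.OnPath f (p.1 n).1 ∨ G.Dev f i (p.1 n).1 := by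
      filter_upwards [G.ae_follow hμ ρ] with p hp n
      induction n with
      | zero => rw [p.2.1]; exact Or.inl OnPath.init
      | succ n ih =>
        have hs := p.2.2 n
        rcases ih with ih | ih
        · by_cases he : (p.1 n).2 = f (p.1 n).1
          · rw [he] at hs
            exact Or.inl (OnPath.step _ _ ih hs.2)
          · by_cases hc : G.ctrl (p.1 n).1 = i
            · exact Or.inr (Dev.first _ _ _ ih hc hs.1 he hs.2)
            · exact absurd ((hp n).trans ((ρg _ hc).trans (g_on _ ih))) he
        · exact Or.inr (Dev.step _ _ _ ih hs.1 hs.2)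
    let H : S → ℝ := fun s => if G.Dev f i s then v i s else U i s
    let K : S → ℝ := fun s => if G.Dev f i s then w i s else Y i s
    have HB : G.Br (u i) H := by
      intro s
      by_cases h : G.Dev f i s
      · simpa [H, h] using hv i s
      · simpa [H, h] using hU i s
    have KB : G.Br (y i) K := by
      intro s
      by_cases h : G.Dev f i s
      · simpa [K, h] using hw i s
      · simpa [K, h] using hY i s
    have key : ∀ s, (G.OnPath f s ∨ G.Dev f i s) → G.Q H s (G.playFun ρ s) ≤ H s ∧
        (G.Q H s (G.playFun ρ s) = H s → G.Q K s (G.playFun ρ s) ≤ K s) := by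
      intro s hs
      rcases hs with hs | hs
      · have nd : ¬ G.Dev f i s := fun h => h.not_onPath hf hs
        have e1 : H s = U i s := by simp [H, nd]
        have e2 : K s = Y i s := by simp [K, nd]
        by_cases he : G.playFun ρ s = f s
        · have hz : ∀ z ∈ (G.q s (f s)).support, ¬ G.Dev f i z := fun z hz h =>
            h.not_onPath hf (OnPath.step _ _ hs hz)
          have e3 : G.Q H s (f s) = G.Q (U i) s (f s) := G.Q_congr fun z h => by simp [H, hz z h]
          have e4 : G.Q K s (f s) = G.Q (Y i) s (f s) := G.Q_congr fun z h => by simp [K, hz z h]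
          rw [he, e1, e2, e3, e4, U1, Y1]
          exact ⟨le_rfl, fun _ => le_rfl⟩
        · have hc : G.ctrl s = i := by
            by_contra hc
            exact he ((ρg s hc).trans (g_on s hs))
          have hz : ∀ z ∈ (G.q s (G.playFun ρ s)).support, G.Dev f i z := fun z hz =>
            Dev.first s z _ hs hc (ρm s) he hz
          have e3 : G.Q H s (G.playFun ρ s) = G.Q (v i) s (G.playFun ρ s) :=
            G.Q_congr fun z h => by simp [H, hz z h]
          have e4 : G.Q K s (G.playFun ρ s) = G.Q (w i) s (G.playFun ρ s) :=
            G.Q_congr fun z h => by simp [K, hz z h]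
          rw [e1, e2, e3, e4]
          obtain ⟨k1, k2⟩ := (hb i s).2.2.2.1 hc _ (ρm s)
          obtain ⟨k3, k4⟩ := UY i s
          refine ⟨k1.trans k3, fun h => ?_⟩
          exact (k2 (le_antisymm k1 (by linarith))).trans (k4 (le_antisymm k3 (by linarith)))
      · have e1 : H s = v i s := by simp [H, hs]
        have e2 : K s = w i s := by simp [K, hs]
        have hz : ∀ z ∈ (G.q s (G.playFun ρ s)).support, G.Dev f i z := fun z hz =>
          Dev.step s z _ hs (ρm s) hz
        have e3 : G.Q H s (G.playFun ρ s) = G.Q (v i) s (G.playFun ρ s) :=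
          G.Q_congr fun z h => by simp [H, hz z h]
        have e4 : G.Q K s (G.playFun ρ s) = G.Q (w i) s (G.playFun ρ s) :=
          G.Q_congr fun z h => by simp [K, hz z h]
        rw [e1, e2, e3, e4]
        by_cases hc : G.ctrl s = i
        · exact (hb i s).2.2.2.1 hc _ (ρm s)
        · rw [ρg s hc, g_dev i s hs, (hb i s).2.1, (hb i s).2.2.1]
          exact ⟨le_rfl, fun _ => le_rfl⟩
    have H0 : H G.init = U i G.init := by simp [H, init_nd i]
    have K0 : K G.init = Y i G.init := by simp [K, init_nd i]
    have s1 := G.super hμ ρ (hu_cont i) (uC i) HB (by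
      filter_upwards [cases_all] with p hp n using (key _ (hp n)).1)
    rw [H0] at s1
    refine ⟨s1.1, fun he => ?_⟩
    rw [← K0]
    refine (G.super hμ ρ (y_cont i) (yC i) KB ?_).1
    filter_upwards [cases_all, s1.2 he] with p hp hq n using (key _ (hp n)).2 (hq n)
  have inty : ∀ (ρ : G.Profile) i, ∫ p, y i p ∂(μ ρ) =
      -∑ j ∈ Finset.univ.erase i, G.epay μ u ρ j := by
    intro ρ i
    have := hμ.1 ρ
    simp only [y, integral_neg, epay]
    rw [integral_finsetSum]
    intro j _
    exact integrable_of_bdd _ (hu_cont j).measurable (uC j)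
  refine ⟨σ, fun i τ => ?_, ?_⟩
  · exact ((dev i τ).1).trans (eqU i).ge
  · rintro ⟨i, τ, h1, h2, k, hk, h3⟩
    have h4 := (dev i τ).2 (h1.trans (eqU i))
    rw [← eqY i, inty, inty] at h4
    have h5 : ∑ j ∈ Finset.univ.erase i, G.epay μ u (G.comb i τ σ) j <
        ∑ j ∈ Finset.univ.erase i, G.epay μ u σ j :=
      Finset.sum_lt_sum (fun j hj => h2 j (Finset.ne_of_mem_erase hj))
        ⟨k, Finset.mem_erase.2 ⟨hk, Finset.mem_univ k⟩, h3⟩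
    linarith

end Main

end PGame

/-- **Existence of secure equilibrium** (Theorem 1): every multi-player
perfect-information game with probabilistic transitions, countable state space,
nonempty finite action sets, and bounded continuous payoff functions admits a
secure equilibrium. -/
theorem exists_secure_equilibrium
    {N S A : Type*} [Finite N] [Countable S]
    (hN : 2 ≤ Nat.card N)
    (G : PGame N S A) (u : N → G.Play → ℝ)
    (hu_bdd : ∀ i : N, ∃ C : ℝ, ∀ p : G.Play, |u i p| ≤ C)
    (hu_cont : ∀ i : N, Continuous (u i))
    (μ : G.Profile → MeasureTheory.Measure G.Play)
    (hμ : G.IsInducedMeasure μ) :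
    ∃ σ : G.Profile, G.IsSecure μ u σ := by
  have := Fintype.ofFinite N
  exact PGame.main_aux u hu_bdd hu_cont μ hμ
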